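/- Let K, A, B, E be finite sets with |K| ≥ 2, and let V : A → B and W : A → E be classical channels (stochastic matrices). Assume that I(P,V) ≥ I(P,W) for every probability distribution P on A. If for every α, β ∈ (0,1) and every sufficiently large n ∈ ℕ there exist a random coder F_A from K to Aⁿ and a decoder f_B : Bⁿ → K such that for every adversary decoder f_E : Eⁿ → K one has Pr[K_A = K_B] ≥ α and I(K_A; K_E) ≤ 1 − β (where K_A is uniform on K, K_B = f_B(Vⁿ(F_A(K_A))), K_E = f_E(Wⁿ(F_A(K_A)))), then max over probability distributions P on A of [I(P,V) − I(P,W)] > 0. -/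

import Mathlib

open scoped BigOperators ComplexOrder

noncomputable section

namespace QKD

/-- A probability distribution on a finite type. -/
def IsProbDist {α : Type*} [Fintype α] (P : α → ℝ) : Prop :=
  (∀ a, 0 ≤ P a) ∧ ∑ a, P a = 1

/-- A classical channel (stochastic matrix) from `α` to `β`. -/
def IsChannel {α β : Type*} [Fintype α] [Fintype β] (V : α → β → ℝ) : Prop :=
  (∀ a b, 0 ≤ V a b) ∧ ∀ a, ∑ b, V a b = 1

/-- Shannon entropy, in bits. -/
def entropy {α : Type*} [Fintype α] (P : α → ℝ) : ℝ :=
  (∑ a, Real.negMulLog (P a)) / Real.log 2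

/-- Shannon mutual information (in bits) of a joint distribution on `α × β`. -/
def miJoint {α β : Type*} [Fintype α] [Fintype β] (J : α → β → ℝ) : ℝ :=
  entropy (fun a => ∑ b, J a b) + entropy (fun b => ∑ a, J a b)
    - entropy (fun p : α × β => J p.1 p.2)

/-- `I(P,V)`: mutual information between input distributed by `P` and output of channel `V`. -/
def chanMI {α β : Type*} [Fintype α] [Fintype β] (P : α → ℝ) (V : α → β → ℝ) : ℝ :=
  miJoint (fun a b => P a * V a b)

/-- The n-fold memoryless extension of a channel. -/
def nfold {α β : Type*} (n : ℕ) (V : α → β → ℝ) : (Fin n → α) → (Fin n → β) → ℝ :=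
  fun a b => ∏ i, V (a i) (b i)

/-- Joint distribution of Alice's key `K_A` (uniform on `K`) and the key obtained
by sending `K_A` through the random coder `F`, the channel `V`, and the decoder `f`. -/
def keyJoint {K A B : Type*} [Fintype K] [Fintype A] [Fintype B] [DecidableEq K]
    (F : K → A → ℝ) (V : A → B → ℝ) (f : B → K) : K → K → ℝ :=
  fun k k' => (Fintype.card K : ℝ)⁻¹ * ∑ a, F k a * ∑ b, if f b = k' then V a b else 0

/-- A density matrix: positive semidefinite with trace 1. -/
def IsDensity {ι : Type*} [Fintype ι] (ρ : Matrix ι ι ℂ) : Prop :=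
  ρ.PosSemidef ∧ ρ.trace = 1

/-- A POVM with outcomes in `B`: positive semidefinite operators summing to the identity. -/
def IsPOVM {ι B : Type*} [Fintype ι] [DecidableEq ι] [Fintype B]
    (M : B → Matrix ι ι ℂ) : Prop :=
  (∀ b, (M b).PosSemidef) ∧ ∑ b, M b = 1

/-- Von Neumann entropy (in bits) of a Hermitian matrix, via its eigenvalues. -/
def vnEntropy {ι : Type*} [Fintype ι] [DecidableEq ι] (ρ : Matrix ι ι ℂ) : ℝ :=
  if h : ρ.IsHermitian then (∑ i, Real.negMulLog (h.eigenvalues i)) / Real.log 2 else 0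

/-- The Holevo quantity χ(P, ξ) of the ensemble `{P(a), ξ(a)}`. -/
def holevo {A ι : Type*} [Fintype A] [Fintype ι] [DecidableEq ι]
    (P : A → ℝ) (ξ : A → Matrix ι ι ℂ) : ℝ :=
  vnEntropy (∑ a, (P a : ℂ) • ξ a) - ∑ a, P a * vnEntropy (ξ a)

/-- Probability of outcome `b` when measuring the state `ρ` with the POVM `M`. -/
def measProb {ι B : Type*} [Fintype ι] (M : B → Matrix ι ι ℂ)
    (ρ : Matrix ι ι ℂ) (b : B) : ℝ :=
  ((M b * ρ).trace).re

/-- Mutual information (in bits) between an input `a ~ P` and the outcome of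
measuring `ξ(a)` with the POVM `M`. -/
def measMI {A ι B : Type*} [Fintype A] [Fintype ι] [Fintype B]
    (P : A → ℝ) (ξ : A → Matrix ι ι ℂ) (M : B → Matrix ι ι ℂ) : ℝ :=
  miJoint (fun a b => P a * measProb M (ξ a) b)

/-- The tensor-power state `ξ(a₁) ⊗ ⋯ ⊗ ξ(a_n)`. -/
def tensPow {A ι : Type*} {n : ℕ} (ξ : A → Matrix ι ι ℂ) (a : Fin n → A) :
    Matrix (Fin n → ι) (Fin n → ι) ℂ :=
  Matrix.of fun v w => ∏ i, ξ (a i) (v i) (w i)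

/-- The set of Holevo quantities over all input distributions. -/
def holevoSet {A ι : Type*} [Fintype A] [Fintype ι] [DecidableEq ι]
    (ξ : A → Matrix ι ι ℂ) : Set ℝ :=
  { x | ∃ P : A → ℝ, IsProbDist P ∧ x = holevo P ξ }

/-- The set of accessible informations: mutual informations achievable with some
input distribution and some POVM (with an arbitrary finite outcome set). -/
def accInfoSet {A ι : Type*} [Fintype A] [Fintype ι] [DecidableEq ι]
    (ξ : A → Matrix ι ι ℂ) : Set ℝ :=
  { x | ∃ (P : A → ℝ) (m : ℕ) (M : Fin m → Matrix ι ι ℂ),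
      IsProbDist P ∧ IsPOVM M ∧ x = measMI P ξ M }


/-- Output entropy functional (in nats) of an unnormalised input measure. -/
def outEnt {α β : Type*} [Fintype α] [Fintype β] (V : α → β → ℝ) (q : α → ℝ) : ℝ :=
  ∑ b, Real.negMulLog (∑ a, q a * V a b)

/-- Conditional entropy (in nats) of the first coordinate given the second. -/
def condEnt {α β : Type*} [Fintype α] [Fintype β] (J : α → β → ℝ) : ℝ :=
  ∑ b, (∑ a, Real.negMulLog (J a b) - Real.negMulLog (∑ a, J a b))

lemma miJoint_eq {α β : Type*} [Fintype α] [Fintype β] (J : α → β → ℝ) :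
    miJoint J = ((∑ a, Real.negMulLog (∑ b, J a b)) - condEnt J) / Real.log 2 := by
  unfold miJoint entropy condEnt
  rw [Fintype.sum_prod_type, Finset.sum_comm, Finset.sum_sub_distrib]
  ring

lemma chanMI_eq {α β : Type*} [Fintype α] [Fintype β] (P : α → ℝ) (V : α → β → ℝ)
    (hV : IsChannel V) :
    chanMI P V = (outEnt V P - ∑ a, P a * ∑ b, Real.negMulLog (V a b)) / Real.log 2 := by
  unfold chanMI miJoint entropy outEnt
  rw [Fintype.sum_prod_type]
  have h1 : ∀ a, ∑ b, P a * V a b = P a := fun a => by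
    rw [← Finset.mul_sum, hV.2 a, mul_one]
  have h2 : ∀ a, ∑ b, Real.negMulLog (P a * V a b)
      = Real.negMulLog (P a) + P a * ∑ b, Real.negMulLog (V a b) := fun a => by
    simp only [Real.negMulLog_mul, Finset.sum_add_distrib]
    rw [← Finset.sum_mul, hV.2 a, one_mul, Finset.mul_sum]
  simp only [h1, h2, Finset.sum_add_distrib]
  ring

lemma outEnt_smul {α β : Type*} [Fintype α] [Fintype β] (V : α → β → ℝ)
    (hV : IsChannel V) (t : ℝ) (q : α → ℝ) :
    outEnt V (fun a => t * q a) = t * outEnt V q + Real.negMulLog t * ∑ a, q a := by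
  unfold outEnt
  have h : ∀ b, ∑ a, t * q a * V a b = t * ∑ a, q a * V a b := fun b => by
    rw [Finset.mul_sum]; exact Finset.sum_congr rfl fun a _ => by ring
  have h2 : ∑ b, ∑ a, q a * V a b = ∑ a, q a := by
    rw [Finset.sum_comm]
    exact Finset.sum_congr rfl fun a _ => by rw [← Finset.mul_sum, hV.2 a, mul_one]
  simp only [h, Real.negMulLog_mul, Finset.sum_add_distrib]
  rw [← Finset.sum_mul, h2, Finset.mul_sum]
  ring

lemma outEnt_lin {A B E : Type*} [Fintype A] [Fintype B] [Fintype E]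
    (V : A → B → ℝ) (W : A → E → ℝ) (hV : IsChannel V) (hW : IsChannel W)
    (heq : ∀ P : A → ℝ, IsProbDist P → chanMI P W = chanMI P V) :
    ∃ c : A → ℝ, ∀ q : A → ℝ, (∀ a, 0 ≤ q a) →
      outEnt V q - outEnt W q = ∑ a, q a * c a := by
  refine ⟨fun a => ∑ b, Real.negMulLog (V a b) - ∑ b, Real.negMulLog (W a b), fun q hq => ?_⟩
  have hl : Real.log 2 ≠ 0 := (Real.log_pos (by norm_num)).ne'
  rcases (Finset.sum_nonneg fun a _ => hq a : 0 ≤ ∑ a, q a).eq_or_lt with h0 | hpos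
  · have hz : ∀ a, q a = 0 := fun a =>
      (Finset.sum_eq_zero_iff_of_nonneg fun a _ => hq a).1 h0.symm a (Finset.mem_univ a)
    simp [outEnt, hz]
  · set t := ∑ a, q a with ht
    set P : A → ℝ := fun a => t⁻¹ * q a with hP
    have hPd : IsProbDist P := by
      refine ⟨fun a => mul_nonneg (inv_nonneg.2 hpos.le) (hq a), ?_⟩
      rw [hP, ← Finset.mul_sum, ← ht, inv_mul_cancel₀ hpos.ne']
    have hqP : q = fun a => t * P a := by
      funext a; simp only [hP]; rw [mul_inv_cancel_left₀ hpos.ne']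
    have h := heq P hPd
    rw [chanMI_eq P V hV, chanMI_eq P W hW, div_left_inj' hl] at h
    rw [hqP, outEnt_smul V hV, outEnt_smul W hW]
    simp only [mul_assoc, ← Finset.mul_sum, mul_sub, Finset.sum_sub_distrib]
    linear_combination (-t) * h

lemma sum_cons {A : Type*} [Fintype A] (n : ℕ) (f : (Fin (n + 1) → A) → ℝ) :
    ∑ a, f a = ∑ a0, ∑ a' : Fin n → A, f (Fin.cons a0 a') := by
  rw [← (Fin.consEquiv (fun _ : Fin (n + 1) => A)).sum_comp, Fintype.sum_prod_type]
  rfl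

lemma nfold_cons {A B : Type*} (n : ℕ) (V : A → B → ℝ) (a0 : A) (a : Fin n → A) (b0 : B)
    (b : Fin n → B) :
    nfold (n + 1) V (Fin.cons a0 a) (Fin.cons b0 b) = V a0 b0 * nfold n V a b := by
  simp [nfold, Fin.prod_univ_succ]

lemma nfold_channel {A B : Type*} [Fintype A] [Fintype B] (n : ℕ) (V : A → B → ℝ)
    (hV : IsChannel V) : IsChannel (nfold n V) := by
  refine ⟨fun a b => Finset.prod_nonneg fun i _ => hV.1 _ _, fun a => ?_⟩
  unfold nfold
  rw [← Fintype.prod_sum]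
  simp [hV.2]

lemma nfold_lin {A B E : Type*} [Fintype A] [Fintype B] [Fintype E]
    (V : A → B → ℝ) (W : A → E → ℝ) (hV : IsChannel V) (hW : IsChannel W) (c : A → ℝ)
    (hc : ∀ q : A → ℝ, (∀ a, 0 ≤ q a) → outEnt V q - outEnt W q = ∑ a, q a * c a) (n : ℕ) :
    ∀ q : (Fin n → A) → ℝ, (∀ a, 0 ≤ q a) →
      outEnt (nfold n V) q - outEnt (nfold n W) q = ∑ a, q a * ∑ i, c (a i) := by
  induction n with
  | zero => intro q hq; simp [outEnt, nfold]
  | succ n ih =>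
    intro q hq
    have hVn := nfold_channel n V hV
    have e1 : outEnt (nfold (n + 1) V) q = ∑ b', outEnt V
        (fun a0 => ∑ a', q (Fin.cons a0 a') * nfold n V a' b') := by
      unfold outEnt
      rw [sum_cons, Finset.sum_comm]
      refine Finset.sum_congr rfl fun b' _ => Finset.sum_congr rfl fun b0 _ => ?_
      rw [sum_cons]
      congr 1
      refine Finset.sum_congr rfl fun a0 _ => ?_
      rw [Finset.sum_mul]
      refine Finset.sum_congr rfl fun a' _ => ?_
      rw [nfold_cons]; ring
    have e2 : ∑ b', outEnt W (fun a0 => ∑ a', q (Fin.cons a0 a') * nfold n V a' b')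
        = ∑ e0, outEnt (nfold n V) (fun a' => ∑ a0, q (Fin.cons a0 a') * W a0 e0) := by
      unfold outEnt
      rw [Finset.sum_comm]
      refine Finset.sum_congr rfl fun b' _ => Finset.sum_congr rfl fun b0 _ => ?_
      congr 1
      simp only [Finset.sum_mul]
      rw [Finset.sum_comm]
      refine Finset.sum_congr rfl fun a0 _ => Finset.sum_congr rfl fun a' _ => ?_
      ring
    have e3 : outEnt (nfold (n + 1) W) q = ∑ e0, outEnt (nfold n W)
        (fun a' => ∑ a0, q (Fin.cons a0 a') * W a0 e0) := by
      unfold outEnt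
      rw [sum_cons]
      refine Finset.sum_congr rfl fun b' _ => Finset.sum_congr rfl fun b0 _ => ?_
      rw [sum_cons]
      congr 1
      rw [Finset.sum_comm]
      refine Finset.sum_congr rfl fun a0 _ => ?_
      rw [Finset.sum_mul]
      refine Finset.sum_congr rfl fun a' _ => ?_
      rw [nfold_cons]; ring
    have d1 : ∑ b', outEnt V (fun a0 => ∑ a', q (Fin.cons a0 a') * nfold n V a' b')
        - ∑ b', outEnt W (fun a0 => ∑ a', q (Fin.cons a0 a') * nfold n V a' b')
        = ∑ a0, ∑ a', q (Fin.cons a0 a') * c a0 := by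
      rw [← Finset.sum_sub_distrib, Finset.sum_congr rfl fun b' _ => hc _ fun a0 =>
        Finset.sum_nonneg fun a' _ => mul_nonneg (hq _) (hVn.1 a' b'), Finset.sum_comm]
      refine Finset.sum_congr rfl fun a0 _ => ?_
      rw [← Finset.sum_mul, Finset.sum_comm, ← Finset.sum_mul]
      congr 1
      exact Finset.sum_congr rfl fun a' _ => by rw [← Finset.mul_sum, hVn.2, mul_one]
    have d2 : ∑ e0, outEnt (nfold n V) (fun a' => ∑ a0, q (Fin.cons a0 a') * W a0 e0)
        - ∑ e0, outEnt (nfold n W) (fun a' => ∑ a0, q (Fin.cons a0 a') * W a0 e0)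
        = ∑ a0, ∑ a' : Fin n → A, q (Fin.cons a0 a') * ∑ i, c (a' i) := by
      rw [← Finset.sum_sub_distrib, Finset.sum_congr rfl fun e0 _ => ih _ fun a' =>
        Finset.sum_nonneg fun a0 _ => mul_nonneg (hq _) (hW.1 a0 e0), Finset.sum_comm,
        Finset.sum_comm (s := (Finset.univ : Finset A))]
      refine Finset.sum_congr rfl fun a' _ => ?_
      rw [← Finset.sum_mul, Finset.sum_comm, ← Finset.sum_mul]
      congr 1
      exact Finset.sum_congr rfl fun a' _ => by rw [← Finset.mul_sum, hW.2, mul_one]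
    have e4 : ∑ a, q a * ∑ i, c (a i) = ∑ a0, ∑ a' : Fin n → A, q (Fin.cons a0 a') * c a0
        + ∑ a0, ∑ a' : Fin n → A, q (Fin.cons a0 a') * ∑ i, c (a' i) := by
      rw [sum_cons]
      simp only [Fin.sum_univ_succ, Fin.cons_zero, Fin.cons_succ, mul_add,
        Finset.sum_add_distrib]
    rw [e1, e3, e4]
    linarith

/-- Joint law of key and channel output. -/
def outJoint {K A B : Type*} [Fintype K] [Fintype A] (F : K → A → ℝ) (V : A → B → ℝ) :
    K → B → ℝ :=
  fun k b => ∑ a, ((Fintype.card K : ℝ)⁻¹ * F k a) * V a b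

lemma condEnt_outJoint {K A B : Type*} [Fintype K] [Fintype A] [Fintype B]
    (F : K → A → ℝ) (V : A → B → ℝ) :
    condEnt (outJoint F V) = ∑ k, outEnt V (fun a => (Fintype.card K : ℝ)⁻¹ * F k a)
      - outEnt V (fun a => ∑ k, (Fintype.card K : ℝ)⁻¹ * F k a) := by
  unfold condEnt outEnt outJoint
  rw [Finset.sum_sub_distrib, Finset.sum_comm]
  congr 1
  refine Finset.sum_congr rfl fun b _ => ?_
  rw [Finset.sum_comm]
  simp only [Finset.sum_mul]

lemma condEnt_eq {K A B E : Type*} [Fintype K] [Fintype A] [Fintype B] [Fintype E]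
    (F : K → A → ℝ) (hF : ∀ k a, 0 ≤ F k a) (V : A → B → ℝ) (W : A → E → ℝ) (c : A → ℝ)
    (hc : ∀ q : A → ℝ, (∀ a, 0 ≤ q a) → outEnt V q - outEnt W q = ∑ a, q a * c a) :
    condEnt (outJoint F V) = condEnt (outJoint F W) := by
  rw [condEnt_outJoint, condEnt_outJoint]
  have hp : ∀ k a, 0 ≤ (Fintype.card K : ℝ)⁻¹ * F k a := fun k a =>
    mul_nonneg (by positivity) (hF k a)
  have h1 := Finset.sum_congr rfl fun (k : K) (_ : k ∈ Finset.univ) => hc _ (hp k)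
  have h2 := hc (fun a => ∑ k, (Fintype.card K : ℝ)⁻¹ * F k a)
    fun a => Finset.sum_nonneg fun k _ => hp k a
  rw [Finset.sum_sub_distrib, Finset.sum_comm] at h1
  simp only [Finset.sum_mul] at h2
  linarith

/-- `x log (s Q / x) ≤ s Q - x`. -/
lemma gibbs_term (x s Q : ℝ) (hx : 0 ≤ x) (hxs : x ≤ s) (hQ : 0 < Q) :
    Real.negMulLog x + x * Real.log s ≤ -(x * Real.log Q) + (s * Q - x) := by
  rcases hx.eq_or_lt with rfl | hx
  · simp; positivity
  · have hs : 0 < s := hx.trans_le hxs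
    have h := Real.log_le_sub_one_of_pos (show 0 < s * Q / x by positivity)
    rw [Real.log_div (by positivity) hx.ne', Real.log_mul hs.ne' hQ.ne'] at h
    have h3 := mul_le_mul_of_nonneg_left h hx.le
    have h4 : x * (s * Q / x - 1) = s * Q - x := by field_simp
    rw [h4] at h3
    unfold Real.negMulLog
    linarith

lemma fano {K B : Type*} [Fintype K] [Fintype B] [DecidableEq K] (J : K → B → ℝ)
    (hJ : ∀ k b, 0 ≤ J k b) (hJ1 : ∑ k, ∑ b, J k b = 1) (f : B → K)
    (δ ε : ℝ) (hδ : 0 < δ) (hδ1 : δ < 1) (hm : 1 ≤ Fintype.card K)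
    (hs : 1 - ε ≤ ∑ b, J (f b) b) :
    condEnt J ≤ -Real.log (1 - δ) + ε * Real.log (Fintype.card K / δ) := by
  have hm' : (1 : ℝ) ≤ Fintype.card K := by exact_mod_cast hm
  set m : ℝ := (Fintype.card K : ℝ) with hmdef
  have hlog : 0 ≤ Real.log (m / δ) := Real.log_nonneg (by rw [le_div_iff₀ hδ]; linarith)
  have hlog2 : Real.log (1 - δ) ≤ 0 := Real.log_nonpos (by linarith) (by linarith)
  have key : ∀ b, ∑ k, Real.negMulLog (J k b) - Real.negMulLog (∑ k, J k b)
      ≤ (∑ k, J k b) * -Real.log (1 - δ) + (∑ k, J k b - J (f b) b) * Real.log (m / δ) := by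
    intro b
    set s := ∑ k, J k b with hsdef
    have hs0 : 0 ≤ s := Finset.sum_nonneg fun k _ => hJ k b
    have hle : ∀ k, J k b ≤ s := fun k =>
      Finset.single_le_sum (f := fun k => J k b) (fun k _ => hJ k b) (Finset.mem_univ k)
    set Q : K → ℝ := fun k => if k = f b then 1 - δ else δ / m with hQ
    have hQp : ∀ k, 0 < Q k := fun k => by
      simp only [hQ]; split_ifs
      · linarith
      · positivity
    have hQs : ∑ k, Q k ≤ 1 := by
      have : ∀ k, Q k ≤ (if k = f b then 1 - δ else 0) + δ / m := fun k => by
        simp only [hQ]; split_ifs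
        · have : 0 < δ / m := by positivity
          linarith
        · linarith
      refine (Finset.sum_le_sum fun k _ => this k).trans ?_
      rw [Finset.sum_add_distrib]
      simp only [Finset.sum_ite_eq', Finset.mem_univ, if_true, Finset.sum_const,
        Finset.card_univ, nsmul_eq_mul, ← hmdef]
      have : m * (δ / m) = δ := by field_simp
      linarith
    have h1 := Finset.sum_le_sum fun (k : K) (_ : k ∈ Finset.univ) =>
      gibbs_term (J k b) s (Q k) (hJ k b) (hle k) (hQp k)
    rw [Finset.sum_add_distrib, Finset.sum_add_distrib, Finset.sum_sub_distrib,
      ← Finset.sum_mul, ← Finset.mul_sum, ← hsdef] at h1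
    have h2 : ∑ k, -(J k b * Real.log (Q k))
        ≤ s * -Real.log (1 - δ) + (s - J (f b) b) * Real.log (m / δ) := by
      have hk : ∀ k, -(J k b * Real.log (Q k)) ≤ J k b * -Real.log (1 - δ)
          + (J k b - if k = f b then J k b else 0) * Real.log (m / δ) := by
        intro k
        simp only [hQ]; split_ifs
        · simp
        · have : Real.log (δ / m) = - Real.log (m / δ) := by
            rw [← Real.log_inv, inv_div]
          rw [this]
          nlinarith [mul_nonneg (hJ k b) (neg_nonneg.2 hlog2)]
      refine (Finset.sum_le_sum fun k _ => hk k).trans ?_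
      rw [Finset.sum_add_distrib, ← Finset.sum_mul, ← Finset.sum_mul, Finset.sum_sub_distrib]
      simp [← hsdef]
    have h3 : s * ∑ k, Q k ≤ s := by nlinarith
    have h4 : Real.negMulLog s = -(s * Real.log s) := by simp [Real.negMulLog]
    linarith
  unfold condEnt
  refine (Finset.sum_le_sum fun b _ => key b).trans ?_
  rw [Finset.sum_add_distrib, ← Finset.sum_mul, ← Finset.sum_mul, Finset.sum_sub_distrib,
    Finset.sum_comm, hJ1]
  have := mul_le_mul_of_nonneg_right (show 1 - ∑ b, J (f b) b ≤ ε by linarith) hlog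
  linarith

lemma map_decoder {K B : Type*} [Fintype K] [Fintype B] [Nonempty K] (J : K → B → ℝ)
    (hJ : ∀ k b, 0 ≤ J k b) (hJ1 : ∑ k, ∑ b, J k b = 1) :
    ∃ f : B → K, 1 - condEnt J ≤ ∑ b, J (f b) b := by
  choose f hf using fun b => Finite.exists_max (fun k => J k b)
  refine ⟨f, ?_⟩
  have key : ∀ b, ∑ k, J k b - J (f b) b
      ≤ ∑ k, Real.negMulLog (J k b) - Real.negMulLog (∑ k, J k b) := by
    intro b
    set s := ∑ k, J k b with hsdef
    have hle : ∀ k, J k b ≤ s := fun k =>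
      Finset.single_le_sum (f := fun k => J k b) (fun k _ => hJ k b) (Finset.mem_univ k)
    have hs0 : 0 ≤ s := Finset.sum_nonneg fun k _ => hJ k b
    rcases hs0.eq_or_lt with h0 | hpos
    · have hz : ∀ k, J k b = 0 := fun k => le_antisymm (h0 ▸ hle k) (hJ k b)
      simp [hz, ← h0]
    · have hk : ∀ k, J k b * (1 - J (f b) b / s)
          ≤ Real.negMulLog (J k b) + J k b * Real.log s := by
        intro k
        rcases (hJ k b).eq_or_lt with h | h
        · simp [← h]
        · have h1 := Real.log_le_sub_one_of_pos (show 0 < J k b / s by positivity)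
          rw [Real.log_div h.ne' hpos.ne'] at h1
          have h2 : J k b / s ≤ J (f b) b / s := by gcongr; exact hf b k
          have h3 := mul_le_mul_of_nonneg_left
            (show 1 - J (f b) b / s ≤ Real.log s - Real.log (J k b) by linarith) h.le
          unfold Real.negMulLog
          linarith
      have h := Finset.sum_le_sum fun (k : K) (_ : k ∈ Finset.univ) => hk k
      rw [Finset.sum_add_distrib, ← Finset.sum_mul, ← Finset.sum_mul, ← hsdef] at h
      have h4 : Real.negMulLog s = -(s * Real.log s) := by simp [Real.negMulLog]
      have h5 : s * (1 - J (f b) b / s) = s - J (f b) b := by field_simp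
      linarith
  have h := Finset.sum_le_sum fun (b : B) (_ : b ∈ Finset.univ) => key b
  rw [Finset.sum_sub_distrib, Finset.sum_comm, hJ1] at h
  unfold condEnt
  linarith

lemma params (η m : ℝ) (hη : 0 < η) (hm : 1 ≤ m) : ∃ δ ε : ℝ, 0 < δ ∧ δ < 1 ∧ 0 < ε ∧ ε < 1 ∧
    -Real.log (1 - δ) + ε * Real.log (m / δ) ≤ η := by
  have he : Real.exp (-(η / 2)) < 1 := Real.exp_lt_one_iff.2 (by linarith)
  have hp := Real.exp_pos (-(η / 2))
  set δ := 1 - Real.exp (-(η / 2)) with hδ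
  have hδ0 : 0 < δ := by linarith
  have hL : 0 ≤ Real.log (m / δ) := Real.log_nonneg (by rw [le_div_iff₀ hδ0]; linarith)
  set L := Real.log (m / δ)
  refine ⟨δ, min (1 / 2) (η / 2 / (L + 1)), hδ0, by linarith, ?_, ?_, ?_⟩
  · positivity
  · exact (min_le_left _ _).trans_lt (by norm_num)
  · have h1 : Real.log (1 - δ) = -(η / 2) := by
      rw [hδ, sub_sub_cancel, Real.log_exp]
    have h2 : min (1 / 2) (η / 2 / (L + 1)) * L ≤ η / 2 / (L + 1) * (L + 1) := by
      gcongr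
      · exact min_le_right _ _
      · linarith
    rw [div_mul_cancel₀ _ (by positivity)] at h2
    rw [h1]; linarith

lemma keyJoint_eq {K A B : Type*} [Fintype K] [Fintype A] [Fintype B] [DecidableEq K]
    (F : K → A → ℝ) (V : A → B → ℝ) (f : B → K) (k k' : K) :
    keyJoint F V f k k' = ∑ b, if f b = k' then outJoint F V k b else 0 := by
  unfold keyJoint outJoint
  rw [Finset.mul_sum]
  simp only [Finset.mul_sum, ← Finset.sum_filter]
  rw [Finset.sum_comm]
  simp only [mul_assoc]

lemma keyJoint_diag {K A B : Type*} [Fintype K] [Fintype A] [Fintype B] [DecidableEq K]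
    (F : K → A → ℝ) (V : A → B → ℝ) (f : B → K) :
    ∑ k, keyJoint F V f k k = ∑ b, outJoint F V (f b) b := by
  simp only [keyJoint_eq]
  rw [Finset.sum_comm]
  simp

lemma keyJoint_marg {K A B : Type*} [Fintype K] [Fintype A] [Fintype B] [DecidableEq K]
    (F : K → A → ℝ) (V : A → B → ℝ) (f : B → K) (k : K) :
    ∑ k', keyJoint F V f k k' = ∑ b, outJoint F V k b := by
  simp only [keyJoint_eq]
  rw [Finset.sum_comm]
  simp

lemma outJoint_marg {K A B : Type*} [Fintype K] [Fintype A] [Fintype B]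
    (F : K → A → ℝ) (V : A → B → ℝ) (hF : IsChannel F) (hV : IsChannel V) (k : K) :
    ∑ b, outJoint F V k b = (Fintype.card K : ℝ)⁻¹ := by
  unfold outJoint
  rw [Finset.sum_comm]
  simp only [← Finset.mul_sum, hV.2, mul_one, hF.2]

lemma outJoint_nonneg {K A B : Type*} [Fintype K] [Fintype A] [Fintype B]
    (F : K → A → ℝ) (V : A → B → ℝ) (hF : IsChannel F) (hV : IsChannel V) (k : K) (b : B) :
    0 ≤ outJoint F V k b :=
  Finset.sum_nonneg fun a _ => mul_nonneg (mul_nonneg (by positivity) (hF.1 k a)) (hV.1 a b)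

/-- **Csiszár–Körner converse (Theorem 1, necessity).**
Suppose `|K| ≥ 2` and `I(P,V) ≥ I(P,W)` for every input distribution `P`. If for
every `α, β ∈ (0,1)` and every sufficiently large `n` there exist a random coder
`F : K → Aⁿ` and a decoder `f_B : Bⁿ → K` such that for every adversary decoder
`f_E : Eⁿ → K` one has `Pr[K_A = K_B] ≥ α` and `I(K_A; K_E) ≤ 1 - β`, then some
input distribution `P` satisfies `I(P,V) - I(P,W) > 0`. -/
theorem csiszarKorner_converse
    {K A B E : Type*} [Fintype K] [Fintype A] [Fintype B] [Fintype E]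
    [DecidableEq K] [Nonempty A]
    (hK : 2 ≤ Fintype.card K)
    (V : A → B → ℝ) (W : A → E → ℝ) (hV : IsChannel V) (hW : IsChannel W)
    (hdom : ∀ P : A → ℝ, IsProbDist P → chanMI P W ≤ chanMI P V)
    (hach : ∀ α β : ℝ, α ∈ Set.Ioo (0 : ℝ) 1 → β ∈ Set.Ioo (0 : ℝ) 1 →
      ∃ N : ℕ, ∀ n, N ≤ n →
        ∃ (F : K → (Fin n → A) → ℝ) (fB : (Fin n → B) → K), IsChannel F ∧
          ∀ fE : (Fin n → E) → K,
            α ≤ ∑ k, keyJoint F (nfold n V) fB k k ∧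
            miJoint (keyJoint F (nfold n W) fE) ≤ 1 - β) :
    ∃ P : A → ℝ, IsProbDist P ∧ 0 < chanMI P V - chanMI P W := by
  by_contra hno
  push Not at hno
  have heq : ∀ P : A → ℝ, IsProbDist P → chanMI P W = chanMI P V := fun P hP =>
    le_antisymm (hdom P hP) (by linarith [hno P hP])
  obtain ⟨c, hc⟩ := outEnt_lin V W hV hW heq
  have hcard : (2 : ℝ) ≤ Fintype.card K := by exact_mod_cast hK
  have hKne : Nonempty K := Fintype.card_pos_iff.1 (by omega)
  have hm0 : (Fintype.card K : ℝ) ≠ 0 := by linarith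
  have hl2 : 0 < Real.log 2 := Real.log_pos (by norm_num)
  obtain ⟨δ₁, ε₁, hδ₁, hδ₁', hε₁, hε₁', hb₁⟩ :=
    params (Real.log 2 / 4) (Fintype.card K) (by linarith) (by linarith)
  obtain ⟨δ₂, ε₂, hδ₂, hδ₂', hε₂, hε₂', hb₂⟩ :=
    params ε₁ (Fintype.card K) hε₁ (by linarith)
  obtain ⟨n, hn⟩ := hach (1 - ε₂) (1 / 2) ⟨by linarith, by linarith⟩ ⟨by norm_num, by norm_num⟩
  obtain ⟨F, fB, hF, h⟩ := hn n le_rfl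
  have hVn := nfold_channel n V hV
  have hWn := nfold_channel n W hW
  have tot : ∑ _k : K, (Fintype.card K : ℝ)⁻¹ = 1 := by
    simp [hm0]
  have hJV : ∑ k, ∑ b, outJoint F (nfold n V) k b = 1 := by
    simp only [outJoint_marg F _ hF hVn]; exact tot
  have hJW : ∑ k, ∑ b, outJoint F (nfold n W) k b = 1 := by
    simp only [outJoint_marg F _ hF hWn]; exact tot
  obtain ⟨fE, hfE⟩ := map_decoder _ (outJoint_nonneg F _ hF hWn) hJW
  obtain ⟨hα, hβ⟩ := h fE
  rw [keyJoint_diag] at hα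
  have hfan := fano _ (outJoint_nonneg F _ hF hVn) hJV fB δ₂ ε₂ hδ₂ hδ₂' (by omega) hα
  rw [condEnt_eq F hF.1 (nfold n V) (nfold n W) _ (nfold_lin V W hV hW c hc n)] at hfan
  have hfan2 := fano (keyJoint F (nfold n W) fE)
    (fun k k' => by
      rw [keyJoint_eq]
      refine Finset.sum_nonneg fun b _ => ?_
      split_ifs
      · exact outJoint_nonneg F _ hF hWn k b
      · exact le_rfl)
    (by simp only [keyJoint_marg]; exact hJW) id δ₁ ε₁ hδ₁ hδ₁' (by omega)
    (by simp only [id]; rw [keyJoint_diag]; linarith)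
  rw [miJoint_eq, div_le_iff₀ hl2] at hβ
  simp only [keyJoint_marg, outJoint_marg F _ hF hWn] at hβ
  have hH : ∑ _k : K, Real.negMulLog (Fintype.card K : ℝ)⁻¹ = Real.log (Fintype.card K) := by
    simp [Real.negMulLog, hm0]
  rw [hH] at hβ
  have := Real.log_le_log (by norm_num) hcard
  linarith

end QKD
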